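/- arXiv:2110.11383 — 6 statements merged into one kernel-verified Lean document; each statement's English description precedes it below -/
import Mathlib

section
/- Concavity of the perturbation function. Let φ₁, φ₂ ∈ ℝ^N be such that the perturbed feasible sets {π : V_i^π(ρ) ≥ b_i + φ_{j,i} for all i = 1,…,N} are nonempty for j = 1, 2. Then for every a ∈ [0,1] the feasible set of the perturbation a·φ₁ + (1−a)·φ₂ is nonempty and P(a·φ₁ + (1−a)·φ₂) ≥ a·P(φ₁) + (1−a)·P(φ₂). -/
open Finset

/-- `π` is a (Markov, stationary) policy: a probability distribution over actions per state. -/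
def IsPolicy {S A : Type*} [Fintype A] (π : S → A → ℝ) : Prop :=
  (∀ s a, 0 ≤ π s a) ∧ ∀ s, ∑ a, π s a = 1

/-- `P` is a transition kernel. -/
def IsKernel {S A : Type*} [Fintype S] (P : S → A → S → ℝ) : Prop :=
  (∀ s a s', 0 ≤ P s a s') ∧ ∀ s a, ∑ s', P s a s' = 1

/-- `ρ` is a probability distribution on `S`. -/
def IsDist {S : Type*} [Fintype S] (ρ : S → ℝ) : Prop :=
  (∀ s, 0 ≤ ρ s) ∧ ∑ s, ρ s = 1

/-- `Q` solves the Bellman equation `Q = r + γ P^π Q` for reward `r`, kernel `P`,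
discount `γ` and policy `π` (for `γ ∈ (0,1)` the solution exists and is unique). -/
def IsBellman {S A : Type*} [Fintype S] [Fintype A]
    (P : S → A → S → ℝ) (γ : ℝ) (r : S → A → ℝ) (π : S → A → ℝ)
    (Q : S → A → ℝ) : Prop :=
  ∀ s a, Q s a = r s a + γ * ∑ s', P s a s' * ∑ a', π s' a' * Q s' a'

/-- The value `V^π(ρ) = ∑_s ρ(s) ∑_a π(a|s) Q(s,a)` computed from a `Q`-table. -/
def Vval {S A : Type*} [Fintype S] [Fintype A]
    (ρ : S → ℝ) (π : S → A → ℝ) (Q : S → A → ℝ) : ℝ :=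
  ∑ s, ρ s * ∑ a, π s a * Q s a

/-- Advantage computed from a `Q`-table: `A(s,a) = Q(s,a) − ∑_{a'} π(a'|s) Q(s,a')`. -/
def adv {S A : Type*} [Fintype A] (π : S → A → ℝ) (Q : S → A → ℝ)
    (s : S) (a : A) : ℝ :=
  Q s a - ∑ a', π s a' * Q s a'

/-- Euclidean norm of a table on `S × A` viewed as a vector in `ℝ^{|S||A|}`. -/
noncomputable def tnorm {S A : Type*} [Fintype S] [Fintype A] (f : S → A → ℝ) : ℝ :=
  Real.sqrt (∑ s, ∑ a, (f s a) ^ 2)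

/-- Sup norm of a table on `S × A`. -/
noncomputable def supnorm {S A : Type*} [Fintype S] [Fintype A] (f : S → A → ℝ) : ℝ :=
  ⨆ p : S × A, |f p.1 p.2|

/-- `d` is the discounted state occupancy vector of `π` started from `ρ`:
`d = ρ + γ (P^π)ᵀ d`. -/
def IsOccupancy {S A : Type*} [Fintype S] [Fintype A] (P : S → A → S → ℝ) (γ : ℝ)
    (ρ : S → ℝ) (π : S → A → ℝ) (d : S → ℝ) : Prop :=
  ∀ s', d s' = ρ s' + γ * ∑ s, ∑ a, d s * π s a * P s a s'

/-- A nonnegative table whose row sums are `D` disintegrates as `D` times a policy. -/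
lemma exists_policy_mul_eq {S A : Type*} [Fintype A] {π₀ m : S → A → ℝ} {D : S → ℝ}
    (hπ₀ : IsPolicy π₀) (hm : ∀ s a, 0 ≤ m s a) (hD : ∀ s, ∑ a, m s a = D s) :
    ∃ π, IsPolicy π ∧ ∀ s a, D s * π s a = m s a := by
  classical
  have hD₀ : ∀ s, 0 ≤ D s := fun s => hD s ▸ Finset.sum_nonneg fun a _ => hm s a
  refine ⟨fun s a => if D s = 0 then π₀ s a else m s a / D s, ⟨fun s a => ?_, fun s => ?_⟩,
    fun s a => ?_⟩
  · dsimp only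
    split_ifs
    · exact hπ₀.1 s a
    · exact div_nonneg (hm s a) (hD₀ s)
  · by_cases h : D s = 0
    · simp [h, hπ₀.2 s]
    · simp [h, ← Finset.sum_div, hD s]
  · by_cases h : D s = 0
    · have := (Finset.sum_eq_zero_iff_of_nonneg fun a _ => hm s a).1 ((hD s).trans h) a
        (Finset.mem_univ a)
      simp [h, this]
    · simp [h, mul_div_cancel₀]

section Occupancy

variable {S A : Type*} [Fintype S] [Fintype A] {P : S → A → S → ℝ} {γ : ℝ} {ρ : S → ℝ}
  {π : S → A → ℝ} {d : S → ℝ}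

lemma sum_flow_eq (hP : IsKernel P) (hπ : IsPolicy π) (d : S → ℝ) :
    ∑ s', ∑ s, ∑ a, d s * π s a * P s a s' = ∑ s, d s := by
  rw [Finset.sum_comm]
  refine Finset.sum_congr rfl fun s _ => ?_
  rw [Finset.sum_comm]
  simp_rw [← Finset.mul_sum, hP.2, mul_one]
  rw [← Finset.mul_sum, hπ.2, mul_one]

lemma IsOccupancy.nonneg (hP : IsKernel P) (hγ : γ ∈ Set.Ioo (0 : ℝ) 1) (hρ : ∀ s, 0 ≤ ρ s)
    (hπ : IsPolicy π) (hd : IsOccupancy P γ ρ π d) (s : S) : 0 ≤ d s := by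
  have hle : ∀ s', max (-d s') 0 ≤ γ * ∑ s, ∑ a, max (-d s) 0 * π s a * P s a s' := by
    intro s'
    apply max_le
    · rw [hd s', neg_add, ← mul_neg, ← Finset.sum_neg_distrib]
      have : ∑ s, -∑ a, d s * π s a * P s a s'
          ≤ ∑ s, ∑ a, max (-d s) 0 * π s a * P s a s' := by
        refine Finset.sum_le_sum fun s _ => ?_
        rw [← Finset.sum_neg_distrib]
        refine Finset.sum_le_sum fun a _ => ?_
        rw [← neg_mul, ← neg_mul]
        exact mul_le_mul_of_nonneg_right
          (mul_le_mul_of_nonneg_right (le_max_left _ _) (hπ.1 s a)) (hP.1 s a s')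
      have := mul_le_mul_of_nonneg_left this hγ.1.le
      linarith [hρ s']
    · exact mul_nonneg hγ.1.le <| Finset.sum_nonneg fun s _ => Finset.sum_nonneg fun a _ =>
        mul_nonneg (mul_nonneg (le_max_right _ _) (hπ.1 s a)) (hP.1 s a s')
  have hsum : ∑ s, max (-d s) 0 ≤ γ * ∑ s, max (-d s) 0 := by
    have := Finset.sum_le_sum fun s' (_ : s' ∈ Finset.univ) => hle s'
    rwa [← Finset.mul_sum, sum_flow_eq hP hπ fun s => max (-d s) 0] at this
  have hs : max (-d s) 0 ≤ ∑ s, max (-d s) 0 :=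
    Finset.single_le_sum (f := fun s => max (-d s) 0) (fun _ _ => le_max_right _ _)
      (Finset.mem_univ s)
  have := le_max_left (-d s) 0
  nlinarith [hγ.2]

/-- The linear map `d ↦ d - γ (P^π)ᵀ d`. -/
def flowMap (P : S → A → S → ℝ) (γ : ℝ) (π : S → A → ℝ) : (S → ℝ) →ₗ[ℝ] (S → ℝ) where
  toFun d s' := d s' - γ * ∑ s, ∑ a, d s * π s a * P s a s'
  map_add' d e := by
    ext s'
    simp only [Pi.add_apply, add_mul, Finset.sum_add_distrib]
    ring
  map_smul' c d := by
    ext s'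
    simp only [Pi.smul_apply, smul_eq_mul, RingHom.id_apply, mul_assoc, ← Finset.mul_sum]
    ring

lemma isOccupancy_iff_flowMap_eq : IsOccupancy P γ ρ π d ↔ flowMap P γ π d = ρ := by
  rw [funext_iff]
  exact forall_congr' fun s' => sub_eq_iff_eq_add.symm

lemma exists_isOccupancy (hP : IsKernel P) (hγ : γ ∈ Set.Ioo (0 : ℝ) 1) (hπ : IsPolicy π)
    (ρ : S → ℝ) : ∃ d, IsOccupancy P γ ρ π d := by
  have hinj : Function.Injective (flowMap P γ π) := by
    rw [← LinearMap.ker_eq_bot, LinearMap.ker_eq_bot']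
    intro d hd
    have hneg : flowMap P γ π (-d) = 0 := by rw [map_neg, hd, neg_zero]
    ext s
    have h₁ := (isOccupancy_iff_flowMap_eq.2 hd).nonneg hP hγ (fun _ => le_rfl) hπ s
    have h₂ := (isOccupancy_iff_flowMap_eq.2 hneg).nonneg hP hγ (fun _ => le_rfl) hπ s
    simp only [Pi.neg_apply, Pi.zero_apply] at h₂ ⊢
    linarith
  obtain ⟨d, hd⟩ := LinearMap.injective_iff_surjective.1 hinj ρ
  exact ⟨d, isOccupancy_iff_flowMap_eq.2 hd⟩

lemma IsOccupancy.Vval_eq {r Q : S → A → ℝ} (hd : IsOccupancy P γ ρ π d)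
    (hQ : IsBellman P γ r π Q) : Vval ρ π Q = ∑ s, ∑ a, d s * π s a * r s a := by
  set v : S → ℝ := fun s => ∑ a, π s a * Q s a with hv
  have hρ : ∀ s, ρ s = d s - γ * ∑ t, ∑ a, d t * π t a * P t a s := fun s => by
    linarith [hd s]
  have hswap : ∑ s', (γ * ∑ s, ∑ a, d s * π s a * P s a s') * v s'
      = ∑ s, ∑ a, d s * π s a * (γ * ∑ s', P s a s' * v s') := by
    simp_rw [Finset.mul_sum, Finset.sum_mul]
    rw [Finset.sum_comm]
    refine Finset.sum_congr rfl fun s _ => ?_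
    rw [Finset.sum_comm]
    exact Finset.sum_congr rfl fun a _ => Finset.sum_congr rfl fun s' _ => by ring
  have hdv : ∑ s, d s * v s = ∑ s, ∑ a, d s * π s a * r s a
      + ∑ s, ∑ a, d s * π s a * (γ * ∑ s', P s a s' * v s') := by
    rw [← Finset.sum_add_distrib]
    refine Finset.sum_congr rfl fun s _ => ?_
    rw [← Finset.sum_add_distrib, hv, Finset.mul_sum]
    exact Finset.sum_congr rfl fun a _ => by rw [hQ s a]; ring
  have : Vval ρ π Q = ∑ s, d s * v s - ∑ s', (γ * ∑ s, ∑ a, d s * π s a * P s a s') * v s' := by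
    rw [← Finset.sum_sub_distrib]
    exact Finset.sum_congr rfl fun s _ => by rw [hρ s, sub_mul]
  rw [this, hdv, hswap, add_sub_cancel_right]

lemma Vval_le {r Q : S → A → ℝ} (hP : IsKernel P) (hγ : γ ∈ Set.Ioo (0 : ℝ) 1) (hρ : IsDist ρ)
    (hπ : IsPolicy π) (hr : ∀ s a, r s a ≤ 1) (hQ : IsBellman P γ r π Q) :
    Vval ρ π Q ≤ 1 / (1 - γ) := by
  obtain ⟨d, hd⟩ := exists_isOccupancy hP hγ hπ ρ
  have hmass : ∑ s, d s = 1 + γ * ∑ s, d s := by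
    conv_lhs => rw [Finset.sum_congr rfl fun s _ => hd s]
    rw [Finset.sum_add_distrib, ← Finset.mul_sum, sum_flow_eq hP hπ, hρ.2]
  calc Vval ρ π Q = ∑ s, ∑ a, d s * π s a * r s a := hd.Vval_eq hQ
    _ ≤ ∑ s, ∑ a, d s * π s a := Finset.sum_le_sum fun s _ => Finset.sum_le_sum fun a _ =>
        mul_le_of_le_one_right (mul_nonneg (hd.nonneg hP hγ hρ.1 hπ s) (hπ.1 s a)) (hr s a)
    _ = ∑ s, d s := by simp_rw [← Finset.mul_sum, hπ.2, mul_one]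
    _ = 1 / (1 - γ) := by
        rw [eq_div_iff (by linarith [hγ.2])]
        linarith

/-- Any convex combination of the values of two policies is attained by a single policy,
simultaneously for all rewards. -/
lemma exists_policy_Vval_eq {π₁ π₂ : S → A → ℝ} (hP : IsKernel P) (hγ : γ ∈ Set.Ioo (0 : ℝ) 1)
    (hρ : ∀ s, 0 ≤ ρ s) (hπ₁ : IsPolicy π₁) (hπ₂ : IsPolicy π₂) {c : ℝ}
    (hc : c ∈ Set.Icc (0 : ℝ) 1) :
    ∃ π, IsPolicy π ∧ ∀ r Q₁ Q₂ Q : S → A → ℝ, IsBellman P γ r π₁ Q₁ → IsBellman P γ r π₂ Q₂ →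
      IsBellman P γ r π Q → Vval ρ π Q = c * Vval ρ π₁ Q₁ + (1 - c) * Vval ρ π₂ Q₂ := by
  obtain ⟨d₁, h₁⟩ := exists_isOccupancy hP hγ hπ₁ ρ
  obtain ⟨d₂, h₂⟩ := exists_isOccupancy hP hγ hπ₂ ρ
  obtain ⟨π, hπ, hm⟩ := exists_policy_mul_eq
    (m := fun s a => c * (d₁ s * π₁ s a) + (1 - c) * (d₂ s * π₂ s a))
    (D := fun s => c * d₁ s + (1 - c) * d₂ s) hπ₁
    (fun s a => add_nonneg
      (mul_nonneg hc.1 (mul_nonneg (h₁.nonneg hP hγ hρ hπ₁ s) (hπ₁.1 s a)))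
      (mul_nonneg (sub_nonneg.2 hc.2) (mul_nonneg (h₂.nonneg hP hγ hρ hπ₂ s) (hπ₂.1 s a))))
    (fun s => by simp_rw [Finset.sum_add_distrib, ← Finset.mul_sum, hπ₁.2, hπ₂.2, mul_one])
  have hlin : ∀ f : S → A → ℝ, ∑ s, ∑ a, (c * d₁ s + (1 - c) * d₂ s) * π s a * f s a
      = c * ∑ s, ∑ a, d₁ s * π₁ s a * f s a + (1 - c) * ∑ s, ∑ a, d₂ s * π₂ s a * f s a := by
    intro f
    simp_rw [hm, Finset.mul_sum, ← Finset.sum_add_distrib]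
    exact Finset.sum_congr rfl fun s _ => Finset.sum_congr rfl fun a _ => by ring
  have hd : IsOccupancy P γ ρ π fun s => c * d₁ s + (1 - c) * d₂ s := by
    intro s'
    rw [hlin fun s a => P s a s']
    dsimp only
    linear_combination c * h₁ s' + (1 - c) * h₂ s'
  refine ⟨π, hπ, fun r Q₁ Q₂ Q hQ₁ hQ₂ hQ => ?_⟩
  rw [hd.Vval_eq hQ, h₁.Vval_eq hQ₁, h₂.Vval_eq hQ₂, hlin]

end Occupancy

lemma mul_csSup_add_mul_csSup_le {X Y : Set ℝ} (hX : X.Nonempty) (hY : Y.Nonempty) {c e M : ℝ}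
    (hc : 0 ≤ c) (he : 0 ≤ e) (h : ∀ x ∈ X, ∀ y ∈ Y, c * x + e * y ≤ M) :
    c * sSup X + e * sSup Y ≤ M := by
  rw [← smul_eq_mul, ← smul_eq_mul, ← Real.sSup_smul_of_nonneg hc,
    ← Real.sSup_smul_of_nonneg he, ← le_sub_iff_add_le]
  refine csSup_le hX.smul_set ?_
  rintro _ ⟨x, hx, rfl⟩
  rw [le_sub_comm]
  refine csSup_le hY.smul_set ?_
  rintro _ ⟨y, hy, rfl⟩
  simpa [le_sub_iff_add_le'] using h x hx y hy

/-- concavity of the perturbation function `P(φ)` of the CMDP. -/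
theorem perturbation_function_concave
    {S A : Type*} [Fintype S] [Fintype A] [Nonempty S] [Nonempty A]
    (N : ℕ) (hN : 1 ≤ N)
    (P : S → A → S → ℝ) (hP : IsKernel P)
    (γ : ℝ) (hγ : γ ∈ Set.Ioo (0:ℝ) 1)
    (r0 : S → A → ℝ) (hr0 : ∀ s a, r0 s a ∈ Set.Icc (0:ℝ) 1)
    (rg : Fin N → S → A → ℝ) (hrg : ∀ i s a, rg i s a ∈ Set.Icc (0:ℝ) 1)
    (ρ : S → ℝ) (hρ : IsDist ρ)
    (b : Fin N → ℝ) (hb : ∀ i, b i ∈ Set.Icc (0:ℝ) (1/(1-γ)))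
    (Q0 : (S → A → ℝ) → S → A → ℝ) (Qg : Fin N → (S → A → ℝ) → S → A → ℝ)
    (hQ0 : ∀ π, IsPolicy π → IsBellman P γ r0 π (Q0 π))
    (hQg : ∀ i π, IsPolicy π → IsBellman P γ (rg i) π (Qg i π))
    (φ₁ φ₂ : Fin N → ℝ)
    (hne₁ : ∃ π, IsPolicy π ∧ ∀ i, Vval ρ π (Qg i π) ≥ b i + φ₁ i)
    (hne₂ : ∃ π, IsPolicy π ∧ ∀ i, Vval ρ π (Qg i π) ≥ b i + φ₂ i)
    (a : ℝ) (ha : a ∈ Set.Icc (0:ℝ) 1) :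
    (∃ π, IsPolicy π ∧ ∀ i, Vval ρ π (Qg i π) ≥ b i + (a * φ₁ i + (1-a) * φ₂ i)) ∧
    sSup {x : ℝ | ∃ π, IsPolicy π ∧
        (∀ i, Vval ρ π (Qg i π) ≥ b i + (a * φ₁ i + (1-a) * φ₂ i)) ∧ x = Vval ρ π (Q0 π)}
      ≥ a * sSup {x : ℝ | ∃ π, IsPolicy π ∧
          (∀ i, Vval ρ π (Qg i π) ≥ b i + φ₁ i) ∧ x = Vval ρ π (Q0 π)}
        + (1-a) * sSup {x : ℝ | ∃ π, IsPolicy π ∧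
          (∀ i, Vval ρ π (Qg i π) ≥ b i + φ₂ i) ∧ x = Vval ρ π (Q0 π)} := by
  have hmix : ∀ π₁ π₂, IsPolicy π₁ → (∀ i, Vval ρ π₁ (Qg i π₁) ≥ b i + φ₁ i) →
      IsPolicy π₂ → (∀ i, Vval ρ π₂ (Qg i π₂) ≥ b i + φ₂ i) →
      ∃ π, IsPolicy π ∧ (∀ i, Vval ρ π (Qg i π) ≥ b i + (a * φ₁ i + (1-a) * φ₂ i)) ∧
        a * Vval ρ π₁ (Q0 π₁) + (1-a) * Vval ρ π₂ (Q0 π₂) = Vval ρ π (Q0 π) := by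
    intro π₁ π₂ hπ₁ hf₁ hπ₂ hf₂
    obtain ⟨π, hπ, hV⟩ := exists_policy_Vval_eq hP hγ hρ.1 hπ₁ hπ₂ ha
    refine ⟨π, hπ, fun i => ?_, (hV _ _ _ _ (hQ0 _ hπ₁) (hQ0 _ hπ₂) (hQ0 _ hπ)).symm⟩
    rw [hV _ _ _ _ (hQg i _ hπ₁) (hQg i _ hπ₂) (hQg i _ hπ)]
    have h₁ := mul_le_mul_of_nonneg_left (hf₁ i) ha.1
    have h₂ := mul_le_mul_of_nonneg_left (hf₂ i) (sub_nonneg.2 ha.2)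
    linarith
  obtain ⟨π₁, hπ₁, hf₁⟩ := hne₁
  obtain ⟨π₂, hπ₂, hf₂⟩ := hne₂
  refine ⟨?_, ?_⟩
  · obtain ⟨π, hπ, hf, -⟩ := hmix π₁ π₂ hπ₁ hf₁ hπ₂ hf₂
    exact ⟨π, hπ, hf⟩
  · rw [ge_iff_le]
    apply mul_csSup_add_mul_csSup_le _ _ ha.1 (sub_nonneg.2 ha.2)
    rotate_left
    · exact ⟨_, π₁, hπ₁, hf₁, rfl⟩
    · exact ⟨_, π₂, hπ₂, hf₂, rfl⟩
    rintro _ ⟨σ₁, hσ₁, hg₁, rfl⟩ _ ⟨σ₂, hσ₂, hg₂, rfl⟩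
    refine le_csSup ⟨1 / (1 - γ), ?_⟩ (hmix σ₁ σ₂ hσ₁ hg₁ hσ₂ hg₂)
    rintro _ ⟨π, hπ, -, rfl⟩
    exact Vval_le hP hγ hρ hπ (fun s a => (hr0 s a).2) (hQ0 π hπ)
end

section
/- From near-optimality of a penalized objective to small constraint violation (appendix Lemma on constraint violation). Assume Slater's condition with margin ξ ∈ (0,1], let π* be an optimal feasible policy, and let λ* ∈ ℝ^N_{≥0} witness strong duality. Let C > 0 with C ≥ 2·max_{1≤i≤N} λ*_i, and write [x]_+ = max(x,0). If a policy π̄ and a real δ > 0 satisfy V_0^{π*}(ρ) − V_0^{π̄}(ρ) + C·∑_{i=1}^{N} [b_i − V_i^{π̄}(ρ)]_+ ≤ δ, then ∑_{i=1}^{N} [b_i − V_i^{π̄}(ρ)]_+ ≤ 2δ/C. -/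
open Finset

/-- A weighted average of a table bounded by `M` is bounded by `M`. -/
theorem sum_weight_mul_le {ι : Type*} [Fintype ι] {w f : ι → ℝ} {M : ℝ}
    (hw : ∀ i, 0 ≤ w i) (hw1 : ∑ i, w i = 1) (hf : ∀ i, f i ≤ M) :
    ∑ i, w i * f i ≤ M :=
  calc ∑ i, w i * f i ≤ ∑ i, w i * M :=
        Finset.sum_le_sum fun i _ => mul_le_mul_of_nonneg_left (hf i) (hw i)
    _ = M := by rw [← Finset.sum_mul, hw1, one_mul]

/-- A solution of the Bellman equation with rewards at most `1` is at most `1 / (1 - γ)`. -/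
theorem IsBellman.le_one_div {S A : Type*} [Fintype S] [Fintype A]
    {P : S → A → S → ℝ} (hP : IsKernel P) {γ : ℝ} (hγ : γ ∈ Set.Ioo (0 : ℝ) 1)
    {r π Q : S → A → ℝ} (hr : ∀ s a, r s a ≤ 1) (hπ : IsPolicy π)
    (hQ : IsBellman P γ r π Q) (s : S) (a : A) : Q s a ≤ 1 / (1 - γ) := by
  have : Nonempty (S × A) := ⟨(s, a)⟩
  obtain ⟨⟨t, c⟩, hmax⟩ := Finite.exists_max fun p : S × A => Q p.1 p.2
  have hle : Q t c ≤ 1 + γ * Q t c := by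
    refine (hQ t c).le.trans (add_le_add (hr t c) (mul_le_mul_of_nonneg_left ?_ hγ.1.le))
    exact sum_weight_mul_le (hP.1 t c) (hP.2 t c) fun s' =>
      sum_weight_mul_le (hπ.1 s') (hπ.2 s') fun a' => hmax (s', a')
  refine (hmax (s, a)).trans ?_
  rw [le_div_iff₀ (sub_pos.2 hγ.2)]
  linarith

theorem IsBellman.vval_le_one_div {S A : Type*} [Fintype S] [Fintype A]
    {P : S → A → S → ℝ} (hP : IsKernel P) {γ : ℝ} (hγ : γ ∈ Set.Ioo (0 : ℝ) 1)
    {r π Q : S → A → ℝ} (hr : ∀ s a, r s a ≤ 1) (hπ : IsPolicy π)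
    (hQ : IsBellman P γ r π Q) {ρ : S → ℝ} (hρ : IsDist ρ) :
    Vval ρ π Q ≤ 1 / (1 - γ) :=
  sum_weight_mul_le hρ.1 hρ.2 fun s =>
    sum_weight_mul_le (hπ.1 s) (hπ.2 s) (hQ.le_one_div hP hγ hr hπ s)

/-- from near-optimality of a penalized objective to small constraint
violation. -/
theorem penalized_to_constraint_violation
    {S A : Type*} [Fintype S] [Fintype A] [Nonempty S] [Nonempty A]
    (N : ℕ) (hN : 1 ≤ N)
    (P : S → A → S → ℝ) (hP : IsKernel P)
    (γ : ℝ) (hγ : γ ∈ Set.Ioo (0:ℝ) 1)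
    (r0 : S → A → ℝ) (hr0 : ∀ s a, r0 s a ∈ Set.Icc (0:ℝ) 1)
    (rg : Fin N → S → A → ℝ) (hrg : ∀ i s a, rg i s a ∈ Set.Icc (0:ℝ) 1)
    (ρ : S → ℝ) (hρ : IsDist ρ)
    (b : Fin N → ℝ) (hb : ∀ i, b i ∈ Set.Icc (0:ℝ) (1/(1-γ)))
    (Q0 : (S → A → ℝ) → S → A → ℝ) (Qg : Fin N → (S → A → ℝ) → S → A → ℝ)
    (hQ0 : ∀ π, IsPolicy π → IsBellman P γ r0 π (Q0 π))
    (hQg : ∀ i π, IsPolicy π → IsBellman P γ (rg i) π (Qg i π))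
    (ξ : ℝ) (hξ : ξ ∈ Set.Ioc (0:ℝ) 1)
    (hSlater : ∃ πb, IsPolicy πb ∧ ∀ i, Vval ρ πb (Qg i πb) - b i ≥ ξ)
    (πstar : S → A → ℝ) (hπs : IsPolicy πstar)
    (hfeas : ∀ i, Vval ρ πstar (Qg i πstar) ≥ b i)
    (hopt : ∀ π, IsPolicy π → (∀ i, Vval ρ π (Qg i π) ≥ b i) →
      Vval ρ π (Q0 π) ≤ Vval ρ πstar (Q0 πstar))
    (lamstar : Fin N → ℝ) (hlamnn : ∀ i, 0 ≤ lamstar i)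
    (hSD : sSup {x : ℝ | ∃ π, IsPolicy π ∧
        x = Vval ρ π (Q0 π) + ∑ i, lamstar i * (Vval ρ π (Qg i π) - b i)}
      = Vval ρ πstar (Q0 πstar))
    (C : ℝ) (hC : 0 < C) (hC2 : ∀ i, 2 * lamstar i ≤ C)
    (πb : S → A → ℝ) (hπb : IsPolicy πb)
    (δ : ℝ) (hδ : 0 < δ)
    (hnear : Vval ρ πstar (Q0 πstar) - Vval ρ πb (Q0 πb)
        + C * ∑ i, max (b i - Vval ρ πb (Qg i πb)) 0 ≤ δ) :
    ∑ i, max (b i - Vval ρ πb (Qg i πb)) 0 ≤ 2 * δ / C := by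
  have hbdd : BddAbove {x : ℝ | ∃ π, IsPolicy π ∧
      x = Vval ρ π (Q0 π) + ∑ i, lamstar i * (Vval ρ π (Qg i π) - b i)} := by
    refine ⟨1 / (1 - γ) + ∑ i, lamstar i * (1 / (1 - γ) - b i), ?_⟩
    rintro x ⟨π, hπ, rfl⟩
    exact add_le_add ((hQ0 π hπ).vval_le_one_div hP hγ (fun s a => (hr0 s a).2) hπ hρ)
      (Finset.sum_le_sum fun i _ => mul_le_mul_of_nonneg_left
        (sub_le_sub_right
          ((hQg i π hπ).vval_le_one_div hP hγ (fun s a => (hrg i s a).2) hπ hρ) _)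
        (hlamnn i))
  have hlag := (le_csSup hbdd ⟨πb, hπb, rfl⟩).trans_eq hSD
  have hpen : -(C / 2 * ∑ i, max (b i - Vval ρ πb (Qg i πb)) 0) ≤
      ∑ i, lamstar i * (Vval ρ πb (Qg i πb) - b i) := by
    rw [Finset.mul_sum, ← Finset.sum_neg_distrib]
    refine Finset.sum_le_sum fun i _ => ?_
    have h1 := mul_le_mul_of_nonneg_left
      (le_max_left (b i - Vval ρ πb (Qg i πb)) 0) (hlamnn i)
    have h2 := mul_le_mul_of_nonneg_right (show lamstar i ≤ C / 2 by linarith [hC2 i])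
      (le_max_right (b i - Vval ρ πb (Qg i πb)) 0)
    linarith
  rw [le_div_iff₀ hC]
  linarith
end

section
/- One-step improvement of the Lagrangian under one natural-policy-gradient softmax step (appendix Lemma 'step improvement'). Let π be a policy with π(a|s) > 0 for all (s,a), let λ ∈ ℝ^N with λ_i ≥ 0 for all i, let α > 0, and let Q̂_i : S×A → ℝ for i = 0,…,N be arbitrary tables. Set Q̂_L = Q̂_0 + ∑_{i=1}^N λ_i Q̂_i, Ẑ(s) = ∑_{a'} π(a'|s)·exp(α Q̂_L(s,a')), V̂_L(s) = ∑_a π(a|s) Q̂_L(s,a), Â_L(s,a) = Q̂_L(s,a) − V̂_L(s), A_L^π = A_0^π + ∑_{i=1}^N λ_i A_i^π, and define the updated policy π'(a|s) = π(a|s)·exp(α Q̂_L(s,a)) / Ẑ(s). Then for every probability distribution μ on S (with V_i^π(μ) = ∑_s μ(s) V_i^π(s)): V_0^{π'}(μ) − V_0^{π}(μ) + ∑_{i=1}^N λ_i (V_i^{π'}(μ) − V_i^{π}(μ)) ≥ (1/α)·∑_s μ(s)·log Ẑ(s) − ∑_s μ(s)·V̂_L(s) − ((3−γ)/(1−γ))·‖A_L^π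 − Â_L‖_∞. -/
open Finset

lemma le_log_sum_mul_exp {A : Type*} [Fintype A] {p : A → ℝ} (hp : ∀ a, 0 ≤ p a)
    (hp1 : ∑ a, p a = 1) (q : A → ℝ) (hZ : 0 < ∑ a, p a * Real.exp (q a)) :
    ∑ a, p a * q a ≤ Real.log (∑ a, p a * Real.exp (q a)) := by
  set Z := ∑ a, p a * Real.exp (q a) with hZdef
  have key : ∑ a, p a * (q a - Real.log Z + 1) ≤ ∑ a, p a * Real.exp (q a) / Z := by
    refine sum_le_sum fun a _ => ?_
    have h := mul_le_mul_of_nonneg_left (Real.add_one_le_exp (q a - Real.log Z)) (hp a)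
    rwa [Real.exp_sub, Real.exp_log hZ, ← mul_div_assoc] at h
  rw [← sum_div, ← hZdef, div_self hZ.ne'] at key
  simp only [mul_add, mul_sub, sum_add_distrib, sum_sub_distrib, ← sum_mul, hp1] at key
  linarith

lemma log_sum_mul_exp_le {A : Type*} [Fintype A] {p : A → ℝ} (hp : ∀ a, 0 ≤ p a)
    (hp1 : ∑ a, p a = 1) (q : A → ℝ) (hZ : 0 < ∑ a, p a * Real.exp (q a)) :
    Real.log (∑ a, p a * Real.exp (q a)) ≤
      ∑ a, p a * Real.exp (q a) / (∑ b, p b * Real.exp (q b)) * q a := by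
  set Z := ∑ a, p a * Real.exp (q a) with hZdef
  have hsum : ∑ a, p a * Real.exp (q a) / Z = 1 := by
    rw [← sum_div, ← hZdef, div_self hZ.ne']
  have key : ∑ a, (p a * Real.exp (q a) / Z - p a) ≤
      ∑ a, p a * Real.exp (q a) / Z * (q a - Real.log Z) := by
    refine sum_le_sum fun a _ => ?_
    have hx : Real.exp (q a) / Z = Real.exp (q a - Real.log Z) := by
      rw [Real.exp_sub, Real.exp_log hZ]
    rw [mul_div_assoc, hx]
    set x := q a - Real.log Z
    have h1 := mul_le_mul_of_nonneg_left (Real.add_one_le_exp (-x))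
      (mul_nonneg (hp a) (Real.exp_pos x).le)
    rw [mul_assoc (p a) (Real.exp x) (Real.exp (-x)), ← Real.exp_add, add_neg_cancel,
      Real.exp_zero] at h1
    linarith
  rw [sum_sub_distrib, hsum, hp1] at key
  simp only [mul_sub, sum_sub_distrib, ← sum_mul, hsum] at key
  linarith

lemma abs_le_supnorm {S A : Type*} [Fintype S] [Fintype A] (f : S → A → ℝ) (s : S) (a : A) :
    |f s a| ≤ supnorm f :=
  le_ciSup (f := fun p : S × A => |f p.1 p.2|) (Set.finite_range _).bddAbove (s, a)

lemma sum_mul_add_sum_smul {A : Type*} [Fintype A] {N : ℕ} (w : A → ℝ) (lam : Fin N → ℝ)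
    (f : A → ℝ) (g : Fin N → A → ℝ) :
    ∑ a, w a * (f a + ∑ i, lam i * g i a) =
      ∑ a, w a * f a + ∑ i, lam i * ∑ a, w a * g i a := by
  simp only [mul_add, sum_add_distrib, mul_sum]
  congr 1
  rw [sum_comm]
  exact sum_congr rfl fun i _ => sum_congr rfl fun a _ => by ring

lemma IsBellman.add_sum {S A : Type*} [Fintype S] [Fintype A] {P : S → A → S → ℝ} {γ : ℝ}
    {π : S → A → ℝ} {N : ℕ} {r Q : S → A → ℝ} {rg Qg : Fin N → S → A → ℝ}
    (h : IsBellman P γ r π Q) (hg : ∀ i, IsBellman P γ (rg i) π (Qg i)) (lam : Fin N → ℝ) :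
    IsBellman P γ (fun s a => r s a + ∑ i, lam i * rg i s a) π
      (fun s a => Q s a + ∑ i, lam i * Qg i s a) := by
  intro s a
  simp only [sum_mul_add_sum_smul]
  have hsum : ∑ i, lam i * Qg i s a = ∑ i, lam i * rg i s a +
      γ * ∑ i, lam i * ∑ s', P s a s' * ∑ a', π s' a' * Qg i s' a' := by
    rw [mul_sum, ← sum_add_distrib]
    exact sum_congr rfl fun i _ => by rw [hg i s a]; ring
  rw [h s a, hsum]
  ring

lemma Vval_add_sum {S A : Type*} [Fintype S] [Fintype A] {N : ℕ} (μ : S → ℝ) (π : S → A → ℝ)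
    (Q : S → A → ℝ) (Qg : Fin N → S → A → ℝ) (lam : Fin N → ℝ) :
    Vval μ π (fun s a => Q s a + ∑ i, lam i * Qg i s a) =
      Vval μ π Q + ∑ i, lam i * Vval μ π (Qg i) := by
  simp only [Vval, sum_mul_add_sum_smul]

lemma adv_add_sum {S A : Type*} [Fintype A] {N : ℕ} (π : S → A → ℝ)
    (Q : S → A → ℝ) (Qg : Fin N → S → A → ℝ) (lam : Fin N → ℝ) (s : S) (a : A) :
    adv π (fun s a => Q s a + ∑ i, lam i * Qg i s a) s a =
      adv π Q s a + ∑ i, lam i * adv π (Qg i) s a := by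
  simp only [adv, sum_mul_add_sum_smul, mul_sub, sum_sub_distrib]
  ring

/-- Performance difference identity, in one-step recursive form. -/
lemma value_sub_value_eq {S A : Type*} [Fintype S] [Fintype A] {P : S → A → S → ℝ} {γ : ℝ}
    {r π π' Q Q' : S → A → ℝ} (hπ' : ∀ s, ∑ a, π' s a = 1)
    (hQ : IsBellman P γ r π Q) (hQ' : IsBellman P γ r π' Q') (s : S) :
    ∑ a, π' s a * Q' s a - ∑ a, π s a * Q s a =
      ∑ a, π' s a * (adv π Q s a +
        γ * ∑ s', P s a s' * (∑ b, π' s' b * Q' s' b - ∑ b, π s' b * Q s' b)) := by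
  have h : ∀ a, adv π Q s a +
        γ * ∑ s', P s a s' * (∑ b, π' s' b * Q' s' b - ∑ b, π s' b * Q s' b) =
      Q' s a - ∑ b, π s b * Q s b := by
    intro a
    simp only [mul_sub (P _ _ _), sum_sub_distrib, adv]
    linarith [hQ s a, hQ' s a]
  simp only [h]
  simp only [mul_sub, sum_sub_distrib, ← sum_mul, hπ', one_mul]

lemma le_of_discounted_recursion {S A : Type*} [Fintype S] [Fintype A] [Nonempty S]
    {P : S → A → S → ℝ} (hP : IsKernel P) {γ : ℝ} (hγ0 : 0 ≤ γ) (hγ1 : γ < 1)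
    {π : S → A → ℝ} (hπ : IsPolicy π) {D f : S → ℝ} {ε : ℝ} (hf : ∀ s, 0 ≤ f s)
    (hD : ∀ s, f s - ε + ∑ a, π s a * (γ * ∑ s', P s a s' * D s') ≤ D s) (s : S) :
    f s - ε / (1 - γ) ≤ D s := by
  obtain ⟨s₀, hs₀⟩ := Finite.exists_min D
  have hmin : ∀ s, f s - ε + γ * D s₀ ≤ D s := by
    intro s
    refine le_trans ?_ (hD s)
    have hb : ∀ a, γ * D s₀ ≤ γ * ∑ s', P s a s' * D s' := fun a => by
      refine mul_le_mul_of_nonneg_left ?_ hγ0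
      calc D s₀ = ∑ s', P s a s' * D s₀ := by rw [← sum_mul, hP.2, one_mul]
        _ ≤ _ := sum_le_sum fun s' _ => mul_le_mul_of_nonneg_left (hs₀ s') (hP.1 s a s')
    have : γ * D s₀ ≤ ∑ a, π s a * (γ * ∑ s', P s a s' * D s') := by
      calc γ * D s₀ = ∑ a, π s a * (γ * D s₀) := by rw [← sum_mul, hπ.2, one_mul]
        _ ≤ _ := sum_le_sum fun a _ => mul_le_mul_of_nonneg_left (hb a) (hπ.1 s a)
    linarith
  have h1γ : 0 < 1 - γ := sub_pos.2 hγ1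
  have hlow : -(ε / (1 - γ)) ≤ D s₀ := by
    rw [← neg_div, div_le_iff₀ h1γ]
    linarith [hmin s₀, hf s₀]
  have hε : ε / (1 - γ) - γ * (ε / (1 - γ)) = ε := by field_simp
  linarith [hmin s, mul_le_mul_of_nonneg_left hlow hγ0]

/-- One softmax step with step size `α` and table `q` improves the value at every state. -/
lemma softmax_step_improvement {S A : Type*} [Fintype S] [Fintype A] [Nonempty S] [Nonempty A]
    {P : S → A → S → ℝ} (hP : IsKernel P) {γ : ℝ} (hγ0 : 0 ≤ γ) (hγ1 : γ < 1)
    {r π π' Q Q' q : S → A → ℝ} (hπ : IsPolicy π) (hπpos : ∀ s a, 0 < π s a)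
    {α : ℝ} (hα : 0 < α)
    (hπ' : ∀ s a, π' s a =
      π s a * Real.exp (α * q s a) / ∑ b, π s b * Real.exp (α * q s b))
    (hQ : IsBellman P γ r π Q) (hQ' : IsBellman P γ r π' Q') (s : S) :
    (1 / α) * Real.log (∑ a, π s a * Real.exp (α * q s a)) - ∑ a, π s a * q s a
        - supnorm (fun s a => adv π Q s a - adv π q s a) / (1 - γ) ≤
      ∑ a, π' s a * Q' s a - ∑ a, π s a * Q s a := by
  have hZ : ∀ s, 0 < ∑ a, π s a * Real.exp (α * q s a) := fun s =>
    sum_pos (fun a _ => mul_pos (hπpos s a) (Real.exp_pos _)) univ_nonempty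
  have hpol : IsPolicy π' := by
    refine ⟨fun s a => ?_, fun s => ?_⟩
    · rw [hπ']
      exact div_nonneg (mul_pos (hπpos s a) (Real.exp_pos _)).le (hZ s).le
    · simp only [hπ']
      rw [← sum_div, div_self (hZ s).ne']
  have hpull : ∀ p : A → ℝ, ∀ s, ∑ a, p a * (α * q s a) = α * ∑ a, p a * q s a := by
    intro p s
    rw [mul_sum]
    exact sum_congr rfl fun a _ => by ring
  refine le_of_discounted_recursion hP hγ0 hγ1 hpol
    (D := fun s => ∑ a, π' s a * Q' s a - ∑ a, π s a * Q s a)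
    (f := fun s => (1 / α) * Real.log (∑ a, π s a * Real.exp (α * q s a)) - ∑ a, π s a * q s a)
    (fun s => ?_) (fun s => ?_) s
  · have h := le_log_sum_mul_exp (hπ.1 s) (hπ.2 s) (fun a => α * q s a) (hZ s)
    rw [hpull] at h
    rw [sub_nonneg, one_div, inv_mul_eq_div, le_div_iff₀ hα]
    linarith
  · have h := log_sum_mul_exp_le (hπ.1 s) (hπ.2 s) (fun a => α * q s a) (hZ s)
    simp only [← hπ', hpull] at h
    rw [← div_le_iff₀' hα] at h
    rw [value_sub_value_eq hpol.2 hQ hQ' s]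
    simp only [mul_add, sum_add_distrib]
    gcongr
    set ε := supnorm (fun s a => adv π Q s a - adv π q s a)
    have hadv : ∑ a, π' s a * (adv π q s a - ε) ≤ ∑ a, π' s a * adv π Q s a := by
      refine sum_le_sum fun a _ => mul_le_mul_of_nonneg_left ?_ (hpol.1 s a)
      linarith [(abs_le.1 (abs_le_supnorm (fun s a => adv π Q s a - adv π q s a) s a)).1]
    simp only [adv, mul_sub, sum_sub_distrib, ← sum_mul, hpol.2, one_mul] at hadv ⊢
    rw [one_div, inv_mul_eq_div]
    linarith

/-- appendix Lemma "step improvement": one-step improvement of the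
Lagrangian under one natural-policy-gradient softmax step. -/
theorem step_improvement
    {S A : Type*} [Fintype S] [Fintype A] [Nonempty S] [Nonempty A]
    (N : ℕ) (hN : 1 ≤ N)
    (P : S → A → S → ℝ) (hP : IsKernel P)
    (γ : ℝ) (hγ : γ ∈ Set.Ioo (0:ℝ) 1)
    (r0 : S → A → ℝ) (hr0 : ∀ s a, r0 s a ∈ Set.Icc (0:ℝ) 1)
    (rg : Fin N → S → A → ℝ) (hrg : ∀ i s a, rg i s a ∈ Set.Icc (0:ℝ) 1)
    (π : S → A → ℝ) (hπ : IsPolicy π) (hπpos : ∀ s a, 0 < π s a)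
    (lam : Fin N → ℝ) (hlam : ∀ i, 0 ≤ lam i)
    (α : ℝ) (hα : 0 < α)
    (Qh0 : S → A → ℝ) (Qhg : Fin N → S → A → ℝ)
    (π' : S → A → ℝ)
    (hπ' : ∀ s a, π' s a =
      π s a * Real.exp (α * (Qh0 s a + ∑ i, lam i * Qhg i s a)) /
        ∑ a', π s a' * Real.exp (α * (Qh0 s a' + ∑ i, lam i * Qhg i s a')))
    (Qπ0 : S → A → ℝ) (Qπg : Fin N → S → A → ℝ)
    (hQπ0 : IsBellman P γ r0 π Qπ0) (hQπg : ∀ i, IsBellman P γ (rg i) π (Qπg i))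
    (Qπ'0 : S → A → ℝ) (Qπ'g : Fin N → S → A → ℝ)
    (hQπ'0 : IsBellman P γ r0 π' Qπ'0) (hQπ'g : ∀ i, IsBellman P γ (rg i) π' (Qπ'g i))
    (μ : S → ℝ) (hμ : IsDist μ) :
    Vval μ π' Qπ'0 - Vval μ π Qπ0
        + ∑ i, lam i * (Vval μ π' (Qπ'g i) - Vval μ π (Qπg i))
      ≥ (1/α) * (∑ s, μ s * Real.log (∑ a', π s a' *
            Real.exp (α * (Qh0 s a' + ∑ i, lam i * Qhg i s a'))))
        - (∑ s, μ s * ∑ a, π s a * (Qh0 s a + ∑ i, lam i * Qhg i s a))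
        - ((3 - γ)/(1 - γ)) * supnorm (fun s a =>
            (adv π Qπ0 s a + ∑ i, lam i * adv π (Qπg i) s a)
              - adv π (fun u c => Qh0 u c + ∑ i, lam i * Qhg i u c) s a) := by
  have hstep := softmax_step_improvement hP hγ.1.le hγ.2 hπ hπpos hα
    (q := fun s a => Qh0 s a + ∑ i, lam i * Qhg i s a) hπ'
    (hQπ0.add_sum hQπg lam) (hQπ'0.add_sum hQπ'g lam)
  simp only [adv_add_sum π Qπ0 Qπg lam] at hstep
  set ε := supnorm (fun s a => (adv π Qπ0 s a + ∑ i, lam i * adv π (Qπg i) s a)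
    - adv π (fun u c => Qh0 u c + ∑ i, lam i * Qhg i u c) s a)
  have hε0 : 0 ≤ ε := Real.iSup_nonneg fun _ => abs_nonneg _
  have hcoef : ε / (1 - γ) ≤ (3 - γ) / (1 - γ) * ε := by
    rw [div_mul_eq_mul_div]
    refine div_le_div_of_nonneg_right ?_ (sub_pos.2 hγ.2).le
    nlinarith [hγ.2]
  have havg := sum_le_sum fun s (_ : s ∈ univ) => mul_le_mul_of_nonneg_left (hstep s) (hμ.1 s)
  simp only [mul_sub (μ _), sum_sub_distrib, ← sum_mul, hμ.2, one_mul] at havg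
  have hV' := Vval_add_sum μ π' Qπ'0 Qπ'g lam
  have hV := Vval_add_sum μ π Qπ0 Qπg lam
  simp only [mul_sub (lam _), sum_sub_distrib]
  rw [mul_sum, sum_congr rfl fun s _ => mul_left_comm (1 / α) (μ s) _]
  unfold Vval at hV hV' ⊢
  linarith
end

section
/- Lipschitz continuity of the Q-function in the policy. Let r : S×A → [0,1] be any reward function and for a policy π let Q_r^π be the unique solution of Q_r^π = r + γ P^π Q_r^π. Then for any two policies π₁ and π₂, ‖Q_r^{π₁} − Q_r^{π₂}‖ ≤ (|S||A|/(1−γ)²)·‖π₁ − π₂‖, where both norms are Euclidean norms of the corresponding tables viewed as vectors in ℝ^{|S||A|}. -/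
open Finset

/-- A convex combination of reals bounded by `M` in absolute value is bounded by `M`. -/
theorem abs_sum_mul_le_of_weights {ι : Type*} [Fintype ι] {w f : ι → ℝ} {M : ℝ}
    (hw : ∀ i, 0 ≤ w i) (hw1 : ∑ i, w i = 1) (hf : ∀ i, |f i| ≤ M) :
    |∑ i, w i * f i| ≤ M := by
  calc |∑ i, w i * f i| ≤ ∑ i, |w i * f i| := Finset.abs_sum_le_sum_abs _ _
    _ ≤ ∑ i, w i * M := by
        refine sum_le_sum fun i _ => ?_
        rw [abs_mul, abs_of_nonneg (hw i)]
        exact mul_le_mul_of_nonneg_left (hf i) (hw i)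
    _ = M := by rw [← sum_mul, hw1, one_mul]

/-- A solution of the Bellman equation with rewards bounded by `b` is bounded by `b / (1 - γ)`. -/
theorem IsBellman.abs_le {S A : Type*} [Fintype S] [Fintype A] {P : S → A → S → ℝ}
    (hP : IsKernel P) {γ : ℝ} (hγ0 : 0 ≤ γ) (hγ1 : γ < 1) {r π Q : S → A → ℝ} {b : ℝ}
    (hπ : IsPolicy π) (hr : ∀ s a, |r s a| ≤ b) (hQ : IsBellman P γ r π Q) (s : S) (a : A) :
    |Q s a| ≤ b / (1 - γ) := by
  obtain ⟨p, -, hp⟩ := exists_max_image (univ : Finset (S × A)) (fun p => |Q p.1 p.2|)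
    ⟨(s, a), mem_univ _⟩
  have hmax : ∀ s' a', |Q s' a'| ≤ |Q p.1 p.2| := fun s' a' => hp (s', a') (mem_univ _)
  have havg : |∑ s', P p.1 p.2 s' * ∑ a', π s' a' * Q s' a'| ≤ |Q p.1 p.2| :=
    abs_sum_mul_le_of_weights (hP.1 p.1 p.2) (hP.2 p.1 p.2) fun s' =>
      abs_sum_mul_le_of_weights (hπ.1 s') (hπ.2 s') (hmax s')
  have hfix : |Q p.1 p.2| ≤ b + γ * |Q p.1 p.2| := by
    conv_lhs => rw [hQ p.1 p.2]
    refine (abs_add_le _ _).trans (add_le_add (hr _ _) ?_)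
    rw [abs_mul, abs_of_nonneg hγ0]
    exact mul_le_mul_of_nonneg_left havg hγ0
  refine (hmax s a).trans ?_
  rw [le_div_iff₀ (sub_pos.2 hγ1)]
  linarith

/-- The difference of two Bellman solutions for the same reward solves a Bellman equation
whose reward is the effect of the policy change on the second solution. -/
theorem IsBellman.sub {S A : Type*} [Fintype S] [Fintype A] {P : S → A → S → ℝ} {γ : ℝ}
    {r π₁ π₂ Q₁ Q₂ : S → A → ℝ} (hQ₁ : IsBellman P γ r π₁ Q₁) (hQ₂ : IsBellman P γ r π₂ Q₂) :
    IsBellman P γ (fun s a => γ * ∑ s', P s a s' * ∑ a', (π₁ s' a' - π₂ s' a') * Q₂ s' a') π₁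
      (fun s a => Q₁ s a - Q₂ s a) := by
  intro s a
  beta_reduce
  rw [hQ₁ s a, hQ₂ s a, add_sub_add_left_eq_sub, ← mul_sub, ← mul_add, ← sum_sub_distrib,
    ← sum_add_distrib]
  congr 1
  refine sum_congr rfl fun s' _ => ?_
  rw [← mul_sub, ← mul_add, ← sum_sub_distrib, ← sum_add_distrib]
  congr 1
  exact sum_congr rfl fun a' _ => by ring

/-- Each row of a table has `ℓ¹` norm at most `√|A|` times the Euclidean norm of the table. -/
theorem sum_abs_le_sqrt_card_mul_tnorm {S A : Type*} [Fintype S] [Fintype A]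
    (f : S → A → ℝ) (s : S) : ∑ a, |f s a| ≤ √(Fintype.card A) * tnorm f := by
  rw [tnorm, ← Real.sqrt_mul (Nat.cast_nonneg _)]
  refine Real.le_sqrt_of_sq_le ((sq_sum_le_card_mul_sum_sq (s := univ)).trans ?_)
  simp only [sq_abs, card_univ]
  exact mul_le_mul_of_nonneg_left
    (single_le_sum (f := fun s => ∑ a, f s a ^ 2)
      (fun _ _ => sum_nonneg fun _ _ => sq_nonneg _) (mem_univ s)) (Nat.cast_nonneg _)

/-- A table with entries bounded by `b` has Euclidean norm at most `√(|S||A|) b`. -/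
theorem tnorm_le_of_abs_le {S A : Type*} [Fintype S] [Fintype A] {f : S → A → ℝ} {b : ℝ}
    (hb : 0 ≤ b) (hf : ∀ s a, |f s a| ≤ b) :
    tnorm f ≤ √(Fintype.card S * Fintype.card A) * b := by
  rw [tnorm, Real.sqrt_le_left (by positivity), mul_pow, Real.sq_sqrt (by positivity)]
  calc ∑ s, ∑ a, f s a ^ 2 ≤ ∑ _s : S, ∑ _a : A, b ^ 2 :=
        sum_le_sum fun s _ => sum_le_sum fun a _ => sq_le_sq' (abs_le.1 (hf s a)).1
          (abs_le.1 (hf s a)).2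
    _ = Fintype.card S * Fintype.card A * b ^ 2 := by simp [mul_assoc]

/-- Lipschitz continuity of the Q-function in the policy. -/
theorem q_lipschitz_in_policy
    {S A : Type*} [Fintype S] [Fintype A] [Nonempty S] [Nonempty A]
    (P : S → A → S → ℝ) (hP : IsKernel P)
    (γ : ℝ) (hγ : γ ∈ Set.Ioo (0:ℝ) 1)
    (r : S → A → ℝ) (hr : ∀ s a, r s a ∈ Set.Icc (0:ℝ) 1)
    (π₁ π₂ : S → A → ℝ) (hπ₁ : IsPolicy π₁) (hπ₂ : IsPolicy π₂)
    (Q₁ Q₂ : S → A → ℝ)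
    (hQ₁ : IsBellman P γ r π₁ Q₁) (hQ₂ : IsBellman P γ r π₂ Q₂) :
    tnorm (fun s a => Q₁ s a - Q₂ s a)
      ≤ ((Fintype.card S : ℝ) * (Fintype.card A : ℝ) / (1-γ)^2) *
        tnorm (fun s a => π₁ s a - π₂ s a) := by
  obtain ⟨hγ0, hγ1⟩ := hγ
  have h1γ : 0 < 1 - γ := sub_pos.2 hγ1
  set T := tnorm fun s a => π₁ s a - π₂ s a
  have hT0 : 0 ≤ T := Real.sqrt_nonneg _
  have hQ₂bound : ∀ s a, |Q₂ s a| ≤ 1 / (1 - γ) :=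
    hQ₂.abs_le hP hγ0.le hγ1 hπ₂ fun s a => abs_le.2 ⟨by linarith [(hr s a).1], (hr s a).2⟩
  have hrow : ∀ s, |∑ a, (π₁ s a - π₂ s a) * Q₂ s a| ≤ √(Fintype.card A) * T / (1 - γ) := by
    intro s
    calc |∑ a, (π₁ s a - π₂ s a) * Q₂ s a| ≤ ∑ a, |(π₁ s a - π₂ s a) * Q₂ s a| :=
          abs_sum_le_sum_abs _ _
      _ ≤ ∑ a, |π₁ s a - π₂ s a| * (1 / (1 - γ)) := sum_le_sum fun a _ => by
          rw [abs_mul]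
          exact mul_le_mul_of_nonneg_left (hQ₂bound s a) (abs_nonneg _)
      _ = (∑ a, |π₁ s a - π₂ s a|) / (1 - γ) := by rw [← sum_mul, mul_one_div]
      _ ≤ √(Fintype.card A) * T / (1 - γ) := div_le_div_of_nonneg_right
          (sum_abs_le_sqrt_card_mul_tnorm (fun s a => π₁ s a - π₂ s a) s) h1γ.le
  have hdiff : ∀ s a, |Q₁ s a - Q₂ s a| ≤ √(Fintype.card A) * T / (1 - γ) / (1 - γ) := by
    refine (hQ₁.sub hQ₂).abs_le hP hγ0.le hγ1 hπ₁ fun s a => ?_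
    rw [abs_mul, abs_of_pos hγ0]
    exact (mul_le_of_le_one_left (abs_nonneg _) hγ1.le).trans
      (abs_sum_mul_le_of_weights (hP.1 s a) (hP.2 s a) hrow)
  have hcard : √(Fintype.card S * Fintype.card A) * √(Fintype.card A) ≤
      (Fintype.card S : ℝ) * Fintype.card A := by
    have hS : (1 : ℝ) ≤ Fintype.card S := Nat.one_le_cast.2 Fintype.card_pos
    rw [Real.sqrt_mul (Nat.cast_nonneg _), mul_assoc, Real.mul_self_sqrt (Nat.cast_nonneg _)]
    exact mul_le_mul_of_nonneg_right
      (Real.sqrt_le_iff.2 ⟨by positivity, le_self_pow₀ hS two_ne_zero⟩) (Nat.cast_nonneg _)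
  calc _ ≤ √(Fintype.card S * Fintype.card A) * (√(Fintype.card A) * T / (1 - γ) / (1 - γ)) :=
        tnorm_le_of_abs_le (by positivity) hdiff
    _ = √(Fintype.card S * Fintype.card A) * √(Fintype.card A) * (T / (1 - γ) ^ 2) := by
        field_simp
    _ ≤ (Fintype.card S : ℝ) * Fintype.card A * (T / (1 - γ) ^ 2) :=
        mul_le_mul_of_nonneg_right hcard (by positivity)
    _ = Fintype.card S * Fintype.card A / (1 - γ) ^ 2 * T := by ring
end

section
/- Negative definiteness of the mean TD-driving matrix (Lemma on M̄). Let ε ∈ (0,1] and let π be a policy with π(a|s) ≥ ε/|A| for all (s,a). Let μ be a probability distribution on S that is stationary for the state chain induced by π, i.e. ∑_s μ(s)·∑_a π(a|s)·P(s'|s,a) = μ(s') for every s' ∈ S, and suppose μ(s) ≥ μ̲ > 0 for all s. Define the matrix M̄ on S×A by M̄((s,a),(s',a')) = μ(s)·π(a|s)·( γ·P(s'|s,a)·π(a'|s') − 1{(s,a)=(s',a')} ). Then for every x : S×A → ℝ, xᵀ M̄ x ≤ −((1−γ)·μ̲·ε/|A|)·‖x‖². -/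
open Finset

/-- The weighted square sum of a table over the pairs `(s, a)`, `(s', a')` of one step of the chain
collapses to the first marginal. -/
lemma sum_step_weight_mul_left {S A : Type*} [Fintype S] [Fintype A]
    {P : S → A → S → ℝ} (hP : IsKernel P) {π : S → A → ℝ} (hπ : IsPolicy π)
    (μ : S → ℝ) (f : S → A → ℝ) :
    ∑ s, ∑ a, ∑ s', ∑ a', μ s * π s a * P s a s' * π s' a' * f s a
      = ∑ s, ∑ a, μ s * π s a * f s a := by
  refine sum_congr rfl fun s _ => sum_congr rfl fun a _ => ?_
  have h (s' : S) : ∑ a', μ s * π s a * P s a s' * π s' a' * f s a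
      = μ s * π s a * f s a * P s a s' := by
    rw [← sum_mul, ← mul_sum, hπ.2]
    ring
  simp_rw [h]
  rw [← mul_sum, hP.2, mul_one]

/-- Under a stationary distribution, the weighted sum of a table over the pairs `(s, a)`, `(s', a')`
of one step of the chain, evaluated at the second pair, is the stationary weighted sum. -/
lemma sum_step_weight_mul_right {S A : Type*} [Fintype S] [Fintype A]
    {P : S → A → S → ℝ} {π : S → A → ℝ} {μ : S → ℝ}
    (hstat : ∀ s', ∑ s, μ s * ∑ a, π s a * P s a s' = μ s') (f : S → A → ℝ) :
    ∑ s, ∑ a, ∑ s', ∑ a', μ s * π s a * P s a s' * π s' a' * f s' a'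
      = ∑ s, ∑ a, μ s * π s a * f s a := by
  have h (s : S) : ∑ a, μ s * π s a * f s a
      = ∑ t, ∑ b, μ t * π t b * P t b s * ∑ a, π s a * f s a := by
    simp_rw [← sum_mul, mul_assoc, ← mul_sum, hstat]
  simp_rw [h, mul_sum, ← mul_assoc]
  symm
  rw [sum_comm]
  exact sum_congr rfl fun s _ => sum_comm

/-- negative definiteness of the mean TD-driving matrix `M̄`. -/
theorem mean_td_matrix_negative_definite
    {S A : Type*} [Fintype S] [Fintype A] [Nonempty S] [Nonempty A]
    [DecidableEq S] [DecidableEq A]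
    (P : S → A → S → ℝ) (hP : IsKernel P)
    (γ : ℝ) (hγ : γ ∈ Set.Ioo (0:ℝ) 1)
    (ε : ℝ) (hε : ε ∈ Set.Ioc (0:ℝ) 1)
    (π : S → A → ℝ) (hπ : IsPolicy π)
    (hπlb : ∀ s a, ε / (Fintype.card A : ℝ) ≤ π s a)
    (μ : S → ℝ) (hμ : IsDist μ)
    (hstat : ∀ s', ∑ s, μ s * ∑ a, π s a * P s a s' = μ s')
    (μlb : ℝ) (hμlb : 0 < μlb) (hμge : ∀ s, μlb ≤ μ s)
    (x : S → A → ℝ) :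
    ∑ s, ∑ a, ∑ s', ∑ a',
        x s a * (μ s * π s a * (γ * P s a s' * π s' a' -
          (if (s, a) = (s', a') then (1:ℝ) else 0))) * x s' a'
      ≤ -((1-γ) * μlb * ε / (Fintype.card A : ℝ)) * ∑ s, ∑ a, (x s a)^2 := by
  obtain ⟨hγ0, hγ1⟩ := hγ
  have hterm (s : S) (a : A) (s' : S) (a' : A) :
      x s a * (μ s * π s a * (γ * P s a s' * π s' a' -
          (if (s, a) = (s', a') then (1:ℝ) else 0))) * x s' a'
        ≤ γ / 2 * (μ s * π s a * P s a s' * π s' a' * x s a ^ 2)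
          + γ / 2 * (μ s * π s a * P s a s' * π s' a' * x s' a' ^ 2)
          - (if s = s' then if a = a' then μ s * π s a * x s a ^ 2 else 0 else 0) := by
    have hw : 0 ≤ γ * (μ s * π s a * P s a s' * π s' a') :=
      mul_nonneg hγ0.le (mul_nonneg (mul_nonneg (mul_nonneg (hμ.1 s) (hπ.1 s a))
        (hP.1 s a s')) (hπ.1 s' a'))
    have hsq := mul_nonneg hw (sq_nonneg (x s a - x s' a'))
    have hdiag : (if s = s' then if a = a' then μ s * π s a * x s a ^ 2 else 0 else 0)
        = x s a * (μ s * π s a * (if (s, a) = (s', a') then (1:ℝ) else 0)) * x s' a' := by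
      by_cases hs : s = s'
      · by_cases ha : a = a'
        · subst hs ha
          simp
          ring
        · simp [ha]
      · simp [hs]
    rw [hdiag]
    linarith
  have hbound : ∑ s, ∑ a, ∑ s', ∑ a',
      x s a * (μ s * π s a * (γ * P s a s' * π s' a' -
          (if (s, a) = (s', a') then (1:ℝ) else 0))) * x s' a'
      ≤ -(1 - γ) * ∑ s, ∑ a, μ s * π s a * x s a ^ 2 := by
    refine (sum_le_sum fun s _ => sum_le_sum fun a _ => sum_le_sum fun s' _ =>
      sum_le_sum fun a' _ => hterm s a s' a').trans_eq ?_
    simp_rw [sum_sub_distrib, sum_add_distrib, ← mul_sum]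
    rw [sum_step_weight_mul_left hP hπ μ fun s a => x s a ^ 2,
      sum_step_weight_mul_right hstat fun s a => x s a ^ 2]
    have hdiag (s : S) (a : A) : ∑ s', ∑ a',
        (if s = s' then if a = a' then μ s * π s a * x s a ^ 2 else 0 else 0)
          = μ s * π s a * x s a ^ 2 := by
      rw [sum_eq_single_of_mem s (mem_univ s) fun t _ ht => by simp [ht.symm]]
      simp
    simp_rw [hdiag]
    ring
  have hlower : μlb * (ε / (Fintype.card A : ℝ)) * ∑ s, ∑ a, x s a ^ 2
      ≤ ∑ s, ∑ a, μ s * π s a * x s a ^ 2 := by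
    simp_rw [mul_sum]
    refine sum_le_sum fun s _ => sum_le_sum fun a _ => ?_
    exact mul_le_mul_of_nonneg_right (mul_le_mul (hμge s) (hπlb s a)
      (div_nonneg hε.1.le (Nat.cast_nonneg _)) (hμ.1 s)) (sq_nonneg _)
  calc _ ≤ -(1 - γ) * ∑ s, ∑ a, μ s * π s a * x s a ^ 2 := hbound
    _ ≤ -(1 - γ) * (μlb * (ε / (Fintype.card A : ℝ)) * ∑ s, ∑ a, x s a ^ 2) :=
      mul_le_mul_of_nonpos_left hlower (by linarith)
    _ = _ := by ring
end

section
/- The softmax map is 1-Lipschitz in the Euclidean norm. For n ≥ 1 and θ ∈ ℝⁿ define softmax(θ)_i = exp(θ_i) / ∑_{j=1}^n exp(θ_j). Then for all θ₁, θ₂ ∈ ℝⁿ, ‖softmax(θ₁) − softmax(θ₂)‖₂ ≤ ‖θ₁ − θ₂‖₂. -/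
open Finset

/-- The softmax map on `ℝⁿ`. -/
noncomputable def softmax {n : ℕ} (θ : Fin n → ℝ) (i : Fin n) : ℝ :=
  Real.exp (θ i) / ∑ j, Real.exp (θ j)

lemma softmax_pos {n : ℕ} (θ : Fin n → ℝ) (i : Fin n) : 0 < softmax θ i :=
  div_pos (Real.exp_pos _) (sum_pos (fun _ _ => Real.exp_pos _) ⟨i, mem_univ i⟩)

lemma sum_softmax {n : ℕ} (hn : 1 ≤ n) (θ : Fin n → ℝ) : ∑ i, softmax θ i = 1 := by
  have hpos : 0 < ∑ j, Real.exp (θ j) :=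
    sum_pos (fun _ _ => Real.exp_pos _) ⟨⟨0, hn⟩, mem_univ _⟩
  simp only [softmax, ← sum_div]
  exact div_self hpos.ne'

lemma hasDerivAt_softmax_line {n : ℕ} (θ d : Fin n → ℝ) (i : Fin n) (t : ℝ) :
    HasDerivAt (fun t : ℝ => softmax (fun j => θ j + t * d j) i)
      (softmax (fun j => θ j + t * d j) i *
        (d i - ∑ j, softmax (fun j => θ j + t * d j) j * d j)) t := by
  have hpos : 0 < ∑ j, Real.exp (θ j + t * d j) :=
    sum_pos (fun _ _ => Real.exp_pos _) ⟨i, mem_univ i⟩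
  have hexp (j : Fin n) :
      HasDerivAt (fun t : ℝ => Real.exp (θ j + t * d j)) (Real.exp (θ j + t * d j) * d j) t := by
    simpa using (((hasDerivAt_id t).mul_const (d j)).const_add (θ j)).exp
  have hsum : HasDerivAt (fun t : ℝ => ∑ j, Real.exp (θ j + t * d j))
      (∑ j, Real.exp (θ j + t * d j) * d j) t :=
    HasDerivAt.fun_sum fun j _ => hexp j
  refine ((hexp i).fun_div hsum hpos.ne').congr_deriv ?_
  simp only [softmax, div_mul_eq_mul_div, ← sum_div]
  field_simp

/-- A covariance with respect to a probability vector is at most the average of the squared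
Euclidean norms. -/
lemma two_mul_sum_mul_sub_le {ι : Type*} [Fintype ι] (p v d : ι → ℝ) (hp : ∀ i, 0 ≤ p i)
    (hsum : ∑ i, p i = 1) :
    2 * ∑ i, v i * (p i * (d i - ∑ j, p j * d j)) ≤ ∑ i, v i ^ 2 + ∑ i, d i ^ 2 := by
  have hp_le (i : ι) : p i ≤ 1 := hsum ▸ single_le_sum (fun j _ => hp j) (mem_univ i)
  have hle (w : ι → ℝ) : ∑ i, p i * w i ^ 2 ≤ ∑ i, w i ^ 2 :=
    sum_le_sum fun i _ => mul_le_of_le_one_left (sq_nonneg _) (hp_le i)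
  set a := ∑ i, p i * v i with ha
  set b := ∑ i, p i * d i with hb
  have hvar : 0 ≤ ∑ i, p i * (v i - d i - (a - b)) ^ 2 :=
    sum_nonneg fun i _ => mul_nonneg (hp i) (sq_nonneg _)
  have hexpand : ∑ i, p i * (v i - d i - (a - b)) ^ 2 =
      ∑ i, p i * v i ^ 2 + ∑ i, p i * d i ^ 2 - 2 * ∑ i, v i * (p i * (d i - b))
        - 2 * a * ∑ i, p i * v i + 2 * (a - b) * ∑ i, p i * d i + (a - b) ^ 2 * ∑ i, p i := by
    simp only [mul_sum, ← sum_add_distrib, ← sum_sub_distrib]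
    exact sum_congr rfl fun i _ => by ring
  rw [hsum, ← ha, ← hb] at hexpand
  nlinarith [hle v, hle d, sq_nonneg a, sq_nonneg b]

/-- the softmax map is 1-Lipschitz in the Euclidean norm. -/
theorem softmax_one_lipschitz (n : ℕ) (hn : 1 ≤ n) (θ₁ θ₂ : Fin n → ℝ) :
    Real.sqrt (∑ i, (softmax θ₁ i - softmax θ₂ i) ^ 2)
      ≤ Real.sqrt (∑ i, (θ₁ i - θ₂ i) ^ 2) := by
  apply Real.sqrt_le_sqrt
  set v : Fin n → ℝ := fun i => softmax θ₁ i - softmax θ₂ i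
  set d : Fin n → ℝ := fun i => θ₁ i - θ₂ i with hd
  have hderiv (t : ℝ) := HasDerivAt.fun_sum (u := univ)
    fun i _ => (hasDerivAt_softmax_line θ₂ d i t).const_mul (v i)
  obtain ⟨t, -, ht⟩ := exists_hasDerivAt_eq_slope _ _ zero_lt_one
    (fun t _ => (hderiv t).continuousAt.continuousWithinAt) fun t _ => hderiv t
  have hbound := two_mul_sum_mul_sub_le (softmax fun j => θ₂ j + t * d j) v d
    (fun i => (softmax_pos _ i).le) (sum_softmax hn _)
  have hslope : ∑ i, v i * (softmax (fun j => θ₂ j + t * d j) i *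
      (d i - ∑ j, softmax (fun j => θ₂ j + t * d j) j * d j)) = ∑ i, v i ^ 2 := by
    rw [ht]
    simp only [hd, one_mul, zero_mul, add_zero, sub_zero, div_one, add_sub_cancel,
      ← sum_sub_distrib, ← mul_sub]
    exact sum_congr rfl fun i _ => (sq (v i)).symm
  change ∑ i, v i ^ 2 ≤ ∑ i, d i ^ 2
  linarith
end
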